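/- Let p ≥ 1 and let G be a finite simple graph with α(G) ≥ 2. Then G ∈ W_p if and only if for every vertex x of G, the localization G_x = G − N_G[x] satisfies G_x ∈ W_p and α(G_x) = α(G) − 1. Moreover, if G ∈ W_p and S is an independent set of G with |S| < α(G), then G_S = G − N_G[S] satisfies G_S ∈ W_p and α(G_S) = α(G) − |S|. -/

import Mathlib

open Finset
open scoped Classical

/-- `S` is an independent set of the graph `G`. -/
def IsIndep {V : Type*} (G : SimpleGraph V) (S : Finset V) : Prop :=
  ∀ ⦃x⦄, x ∈ S → ∀ ⦃y⦄, y ∈ S → x ≠ y → ¬ G.Adj x y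

/-- The independence number `α(G)` of a finite graph `G`. -/
noncomputable def alpha {V : Type*} [Fintype V] (G : SimpleGraph V) : ℕ :=
  Finset.univ.sup fun S : Finset V => if IsIndep G S then S.card else 0

/-- `S` is a maximum independent set of `G`. -/
def IsMaxIndep {V : Type*} [Fintype V] (G : SimpleGraph V) (S : Finset V) : Prop :=
  IsIndep G S ∧ S.card = alpha G

/-- `S` is a maximal (inclusion-wise) independent set of `G`. -/
def IsMaximalIndep {V : Type*} [DecidableEq V] (G : SimpleGraph V) (S : Finset V) : Prop :=
  IsIndep G S ∧ ∀ x, x ∉ S → ¬ IsIndep G (insert x S)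

/-- `G` is well-covered: every maximal independent set has cardinality `α(G)`. -/
def WellCovered {V : Type*} [Fintype V] [DecidableEq V] (G : SimpleGraph V) : Prop :=
  ∀ S : Finset V, IsMaximalIndep G S → S.card = alpha G

/-- `G ∈ W_p`: `|V(G)| ≥ p` and every `p` pairwise disjoint independent sets extend to
`p` pairwise disjoint maximum independent sets. -/
def MemW {V : Type*} [Fintype V] (G : SimpleGraph V) (p : ℕ) : Prop :=
  p ≤ Fintype.card V ∧
    ∀ A : Fin p → Finset V, (∀ i, IsIndep G (A i)) →
      (∀ i j, i ≠ j → Disjoint (A i) (A j)) →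
      ∃ M : Fin p → Finset V, (∀ i, IsMaxIndep G (M i)) ∧
        (∀ i j, i ≠ j → Disjoint (M i) (M j)) ∧ ∀ i, A i ⊆ M i

/-- The `W`-index of `G`: the largest `p` with `G ∈ W_p`. -/
noncomputable def wIndex {V : Type*} [Fintype V] (G : SimpleGraph V) : ℕ :=
  sSup {p : ℕ | MemW G p}

/-- The fiber `F_G(S)`: the vertices `x ∉ S` with `S ∪ {x}` a maximum independent set. -/
noncomputable def fiber {V : Type*} [Fintype V] [DecidableEq V]
    (G : SimpleGraph V) (S : Finset V) : Finset V :=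
  Finset.univ.filter fun x => x ∉ S ∧ IsMaxIndep G (insert x S)

/-- `G` is `α`-critical: deleting any edge increases the independence number. -/
def AlphaCritical {V : Type*} [Fintype V] (G : SimpleGraph V) : Prop :=
  ∀ x y, G.Adj x y → alpha G < alpha (G.deleteEdges {s(x, y)})

/-- `H` is `K_t`-saturated: `H` is `K_t`-free but adding any missing edge creates a `K_t`. -/
def KSaturated {V : Type*} [Fintype V] (H : SimpleGraph V) (t : ℕ) : Prop :=
  (∀ Q : Finset V, ¬ H.IsNClique t Q) ∧
    ∀ x y : V, x ≠ y → ¬ H.Adj x y →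
      ∃ Q : Finset V, (H ⊔ SimpleGraph.fromEdgeSet {s(x, y)}).IsNClique t Q

/-- `Q` is an inclusion-maximal clique of `H`. -/
def IsMaximalClique {V : Type*} [DecidableEq V] (H : SimpleGraph V) (Q : Finset V) : Prop :=
  H.IsClique (Q : Set V) ∧ ∀ x, x ∉ Q → ¬ H.IsClique ((insert x Q : Finset V) : Set V)

/-- The `(r-1)`-clique-codegree of `Q` in `H`: the number of vertices extending `Q`
to an `r`-clique of `H`. -/
noncomputable def codeg {V : Type*} [Fintype V] [DecidableEq V]
    (H : SimpleGraph V) (r : ℕ) (Q : Finset V) : ℕ :=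
  (Finset.univ.filter fun x => x ∉ Q ∧ H.IsNClique r (insert x Q)).card

/-- The minimum `(r-1)`-clique-codegree `δ^cl_{r-1}(H)`. -/
noncomputable def minCliqueCodeg {V : Type*} [Fintype V] [DecidableEq V]
    (H : SimpleGraph V) (r : ℕ) : ℕ :=
  sInf {m : ℕ | ∃ Q : Finset V, H.IsNClique (r - 1) Q ∧ codeg H r Q = m}

/-- The vertex set of the localization `G_S = G - N_G[S]`. -/
noncomputable def localVerts {V : Type*} [Fintype V] (G : SimpleGraph V) (S : Finset V) :
    Finset V :=
  Finset.univ.filter fun v => v ∉ S ∧ ∀ s ∈ S, ¬ G.Adj s v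

/-- The localization `G_S = G - N_G[S]`, as an induced subgraph. -/
noncomputable def localize {V : Type*} [Fintype V] (G : SimpleGraph V) (S : Finset V) :
    SimpleGraph {v : V // v ∈ localVerts G S} :=
  SimpleGraph.comap (fun v => (v : V)) G

/-- The vertex set of the edge-localization `G_{ab} = G - (N_G(a) ∪ N_G(b))`. -/
noncomputable def edgeVerts {V : Type*} [Fintype V] (G : SimpleGraph V) (a b : V) : Finset V :=
  Finset.univ.filter fun v => ¬ G.Adj a v ∧ ¬ G.Adj b v

/-- The edge-localization `G_{ab} = G - (N_G(a) ∪ N_G(b))`, as an induced subgraph. -/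
noncomputable def edgeLocalize {V : Type*} [Fintype V] (G : SimpleGraph V) (a b : V) :
    SimpleGraph {v : V // v ∈ edgeVerts G a b} :=
  SimpleGraph.comap (fun v => (v : V)) G

section IndependentSets

variable {V : Type*} {G : SimpleGraph V}

theorem IsIndep.subset {S T : Finset V} (hT : IsIndep G T) (h : S ⊆ T) : IsIndep G S :=
  fun _ hx _ hy => hT (h hx) (h hy)

theorem isIndep_singleton (x : V) : IsIndep G {x} := by
  intro a ha b hb hab
  simp_all

variable [Fintype V]

theorem IsIndep.card_le_alpha {S : Finset V} (hS : IsIndep G S) : S.card ≤ alpha G := by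
  have := Finset.le_sup (f := fun S : Finset V => if IsIndep G S then S.card else 0)
    (Finset.mem_univ S)
  simpa [hS, alpha] using this

variable (G) in
theorem exists_isMaxIndep : ∃ S : Finset V, IsMaxIndep G S := by
  obtain ⟨S, -, hS⟩ := Finset.exists_mem_eq_sup Finset.univ Finset.univ_nonempty
    (fun S : Finset V => if IsIndep G S then S.card else 0)
  change alpha G = _ at hS
  by_cases h : IsIndep G S
  · exact ⟨S, h, by simpa [h] using hS.symm⟩
  · refine ⟨∅, by simp [IsIndep], ?_⟩
    simpa [h] using hS.symm

theorem mem_localVerts {S : Finset V} {v : V} :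
    v ∈ localVerts G S ↔ v ∉ S ∧ ∀ s ∈ S, ¬ G.Adj s v := by
  simp [localVerts]

theorem disjoint_localVerts {S T : Finset V} (h : T ⊆ localVerts G S) : Disjoint S T :=
  Finset.disjoint_right.2 fun _ hv => (mem_localVerts.1 (h hv)).1

variable [DecidableEq V]

theorem IsIndep.union {S T : Finset V} (hS : IsIndep G S) (hT : IsIndep G T)
    (h : T ⊆ localVerts G S) : IsIndep G (S ∪ T) := by
  intro x hx y hy hxy
  rw [Finset.mem_union] at hx hy
  rcases hx with hx | hx <;> rcases hy with hy | hy
  · exact hS hx hy hxy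
  · exact (mem_localVerts.1 (h hy)).2 x hx
  · exact fun e => (mem_localVerts.1 (h hx)).2 y hy e.symm
  · exact hT hx hy hxy

theorem IsIndep.insert {S : Finset V} {v : V} (hS : IsIndep G S) (h : v ∈ localVerts G S) :
    IsIndep G (insert v S) := by
  rw [Finset.insert_eq, Finset.union_comm]
  exact hS.union (isIndep_singleton v) (by simpa using h)

theorem IsIndep.sdiff_subset_localVerts {S T : Finset V} (hT : IsIndep G T) (h : S ⊆ T) :
    T \ S ⊆ localVerts G S := by
  intro v hv
  rw [Finset.mem_sdiff] at hv
  refine mem_localVerts.2 ⟨hv.2, fun s hs => hT (h hs) hv.1 ?_⟩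
  rintro rfl
  exact hv.2 hs

theorem localVerts_union {S T : Finset V} {v : V} :
    v ∈ localVerts G (S ∪ T) ↔
      v ∈ localVerts G S ∧ v ∉ T ∧ ∀ t ∈ T, ¬ G.Adj t v := by
  simp only [mem_localVerts, Finset.mem_union]
  grind

/-- The vertices completing a set of size `α(G) - 1` are pairwise adjacent. -/
theorem adj_of_mem_localVerts {S : Finset V} (hS : IsIndep G S) (hc : S.card + 1 = alpha G)
    {a b : V} (ha : a ∈ localVerts G S) (hb : b ∈ localVerts G S) (hab : a ≠ b) :
    G.Adj a b := by
  by_contra h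
  have hb' : b ∈ localVerts G (insert a S) := by
    rw [mem_localVerts] at ha hb ⊢
    simp only [Finset.mem_insert]
    grind
  have := ((hS.insert ha).insert hb').card_le_alpha
  rw [Finset.card_insert_of_notMem (mem_localVerts.1 hb').1,
    Finset.card_insert_of_notMem (mem_localVerts.1 ha).1] at this
  omega

end IndependentSets

section MembershipCriterion

variable {V : Type*} [Fintype V] {G : SimpleGraph V}

/-- Every independent set extends to a maximum one, and every independent set of size
`α(G) - 1` does so in at least `p` ways. -/
def HasLargeFibers (G : SimpleGraph V) (p : ℕ) : Prop :=
  (∀ A : Finset V, IsIndep G A → ∃ M, IsMaxIndep G M ∧ A ⊆ M) ∧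
    ∀ S : Finset V, IsIndep G S → S.card + 1 = alpha G → p ≤ (localVerts G S).card

theorem MemW.hasLargeFibers {p : ℕ} (h : MemW G p) (hp : 1 ≤ p) : HasLargeFibers G p := by
  obtain ⟨q, rfl⟩ : ∃ q, p = q + 1 := ⟨p - 1, by omega⟩
  refine ⟨fun A hA => ?_, fun S hS hc => ?_⟩
  · obtain ⟨M, hM, -, hAM⟩ := h.2 (fun i => if i = 0 then A else ∅)
      (by intro i; split_ifs; exacts [hA, by simp [IsIndep]])
      (by intro i j hij; split_ifs <;> simp_all)
    exact ⟨M 0, hM 0, by simpa using hAM 0⟩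
  · by_contra! hlt
    let e : localVerts G S → Fin (q + 1) := fun x =>
      ((localVerts G S).equivFin x).succ.castLE (by omega)
    have he : Function.Injective e := by
      intro a b hab
      simpa [e] using hab
    have he0 : ∀ x, e x ≠ 0 := by
      intro x hx
      simp [e, Fin.ext_iff] at hx
    let B : Fin (q + 1) → Finset V := fun i =>
      Finset.univ.filter fun v => ∃ hv : v ∈ localVerts G S, e ⟨v, hv⟩ = i
    have hB : ∀ i v, v ∈ B i ↔ ∃ hv : v ∈ localVerts G S, e ⟨v, hv⟩ = i := by
      intro i v
      simp [B]
    obtain ⟨M, hM, hdis, hAM⟩ := h.2 (fun i => if i = 0 then S else B i) (by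
        intro i
        split_ifs
        · exact hS
        · intro x hx y hy hxy
          obtain ⟨hx', hx⟩ := (hB _ _).1 hx
          obtain ⟨hy', hy⟩ := (hB _ _).1 hy
          exact absurd (congrArg Subtype.val (he (hx.trans hy.symm))) hxy) (by
        intro i j hij
        rw [Finset.disjoint_left]
        intro v hv hv'
        split_ifs at hv hv' with h1 h2 h2
        · exact hij (h1.trans h2.symm)
        · obtain ⟨hm, -⟩ := (hB _ _).1 hv'
          exact (mem_localVerts.1 hm).1 hv
        · obtain ⟨hm, -⟩ := (hB _ _).1 hv
          exact (mem_localVerts.1 hm).1 hv'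
        · obtain ⟨hm, e1⟩ := (hB _ _).1 hv
          obtain ⟨hm', e2⟩ := (hB _ _).1 hv'
          exact hij (e1.symm.trans e2))
    have hSM : S ⊆ M 0 := by simpa using hAM 0
    obtain ⟨x, hx⟩ : (M 0 \ S).Nonempty := by
      rw [← Finset.card_pos, Finset.card_sdiff_of_subset hSM, (hM 0).2]
      omega
    have hxl := (hM 0).1.sdiff_subset_localVerts hSM hx
    have hxM : x ∈ M (e ⟨x, hxl⟩) := by
      apply hAM
      simp only [he0, if_false]
      exact (hB _ _).2 ⟨hxl, rfl⟩
    exact Finset.disjoint_left.1 (hdis _ _ (he0 ⟨x, hxl⟩)) hxM (Finset.mem_sdiff.1 hx).1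

/-- One member of a disjoint family of independent sets can be made maximum while staying
disjoint from the others. -/
theorem HasLargeFibers.exists_extension {p : ℕ} (h : HasLargeFibers G p)
    {A : Fin p → Finset V} (hA : ∀ i, IsIndep G (A i))
    (hd : ∀ i j, i ≠ j → Disjoint (A i) (A j)) (i : Fin p) :
    ∃ M, IsMaxIndep G M ∧ A i ⊆ M ∧ ∀ j, j ≠ i → Disjoint M (A j) := by
  let U : Finset V := (Finset.univ.erase i).biUnion A
  have hU : ∀ v, v ∈ U ↔ ∃ j, j ≠ i ∧ v ∈ A j := by
    intro v
    simp [U]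
  obtain ⟨M₀, hM₀, hAM₀⟩ := h.1 (A i) (hA i)
  obtain ⟨M, hM, hmin⟩ := Finset.exists_min_image
    (Finset.univ.filter fun M => IsMaxIndep G M ∧ A i ⊆ M) (fun M => (M ∩ U).card)
    ⟨M₀, by simp [hM₀, hAM₀]⟩
  simp only [Finset.mem_filter, Finset.mem_univ, true_and] at hM hmin
  obtain ⟨hM, hAM⟩ := hM
  refine ⟨M, hM, hAM, fun j hj => Finset.disjoint_left.2 fun b hbM hbA => ?_⟩
  have hbU : b ∈ U := (hU b).2 ⟨j, hj, hbA⟩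
  have hS : IsIndep G (M.erase b) := hM.1.subset (Finset.erase_subset _ _)
  have hc : (M.erase b).card + 1 = alpha G := by
    rw [Finset.card_erase_add_one hbM, hM.2]
  obtain ⟨c, hcl, hcU⟩ : ∃ c ∈ localVerts G (M.erase b), c ∉ U := by
    by_contra! hall
    have : Nonempty (Fin p) := ⟨i⟩
    choose! f hf using fun c hc => (hU c).1 (hall c hc)
    have hlt : (Finset.univ.erase i).card < (localVerts G (M.erase b)).card := by
      have := h.2 _ hS hc
      have := i.pos
      rw [Finset.card_erase_of_mem (Finset.mem_univ i), Finset.card_univ, Fintype.card_fin]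
      omega
    obtain ⟨x, hx, y, hy, hxy, hfxy⟩ := Finset.exists_ne_map_eq_of_card_lt_of_maps_to
      (f := f) hlt (fun c hc => by simpa using (hf c hc).1)
    exact hA (f x) (hf x hx).2 (hfxy ▸ (hf y hy).2) hxy
      (adj_of_mem_localVerts hS hc hx hy hxy)
  have hle := hmin (insert c (M.erase b)) ⟨⟨hS.insert hcl, by
      rw [Finset.card_insert_of_notMem (mem_localVerts.1 hcl).1, hc]⟩, fun a ha => by
    refine Finset.mem_insert_of_mem (Finset.mem_erase.2 ⟨?_, hAM ha⟩)
    rintro rfl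
    exact Finset.disjoint_left.1 (hd j i hj) hbA ha⟩
  have hlt : (insert c (M.erase b) ∩ U).card < (M ∩ U).card := by
    apply Finset.card_lt_card
    rw [Finset.insert_inter_of_notMem hcU, Finset.erase_inter]
    exact Finset.erase_ssubset (Finset.mem_inter.2 ⟨hbM, hbU⟩)
  omega

theorem HasLargeFibers.memW {p : ℕ} (h : HasLargeFibers G p) (hα : 1 ≤ alpha G) :
    MemW G p := by
  constructor
  · obtain ⟨M, hM⟩ := exists_isMaxIndep G
    obtain ⟨b, hb⟩ : M.Nonempty := Finset.card_pos.1 (by rw [hM.2]; omega)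
    exact (h.2 (M.erase b) (hM.1.subset (Finset.erase_subset _ _))
      (by rw [Finset.card_erase_add_one hb, hM.2])).trans (Finset.card_le_univ _)
  · intro A hA hd
    have key : ∀ s : Finset (Fin p), ∃ M : Fin p → Finset V, (∀ i, IsIndep G (M i)) ∧
        (∀ i j, i ≠ j → Disjoint (M i) (M j)) ∧ (∀ i, A i ⊆ M i) ∧
        ∀ i ∈ s, IsMaxIndep G (M i) := by
      intro s
      induction s using Finset.induction_on with
      | empty => exact ⟨A, hA, hd, fun _ => subset_rfl, by simp⟩
      | insert k s _ ih =>
        obtain ⟨M, hM, hdM, hAM, hs⟩ := ih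
        obtain ⟨N, hN, hMN, hNd⟩ := h.exists_extension hM hdM k
        refine ⟨Function.update M k N, fun i => ?_, fun i j hij => ?_, fun i => ?_,
          fun i hi => ?_⟩
        · rcases eq_or_ne i k with rfl | hi
          · simpa using hN.1
          · simpa [hi] using hM i
        · rcases eq_or_ne i k with rfl | hi
          · simpa [hij.symm] using hNd j hij.symm
          · rcases eq_or_ne j k with rfl | hj
            · simpa [hi] using (hNd i hi).symm
            · simpa [hi, hj] using hdM i j hij
        · rcases eq_or_ne i k with rfl | hi
          · simpa using (hAM i).trans hMN
          · simpa [hi] using hAM i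
        · rcases eq_or_ne i k with rfl | hik
          · simpa using hN
          · simpa [hik] using hs i ((Finset.mem_insert.1 hi).resolve_left hik)
    obtain ⟨M, -, hdM, hAM, hM⟩ := key Finset.univ
    exact ⟨M, fun i => hM i (Finset.mem_univ i), hdM, hAM⟩

end MembershipCriterion

section Localization

variable {V : Type*} [Fintype V] {G : SimpleGraph V} {S : Finset V}

/-- A vertex set of the localization, viewed in the ambient graph. -/
def ambient (T : Finset {v : V // v ∈ localVerts G S}) : Finset V :=
  T.map (Function.Embedding.subtype _)

theorem ambient_subset (T : Finset {v : V // v ∈ localVerts G S}) :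
    ambient T ⊆ localVerts G S := by
  intro v hv
  obtain ⟨w, -, rfl⟩ := Finset.mem_map.1 hv
  exact w.2

theorem card_ambient (T : Finset {v : V // v ∈ localVerts G S}) :
    (ambient T).card = T.card :=
  Finset.card_map _

theorem exists_ambient_eq {T : Finset V} (hT : T ⊆ localVerts G S) :
    ∃ T' : Finset {v : V // v ∈ localVerts G S}, ambient T' = T :=
  ⟨T.subtype _, Finset.subtype_map_of_mem hT⟩

theorem isIndep_localize (T : Finset {v : V // v ∈ localVerts G S}) :
    IsIndep (localize G S) T ↔ IsIndep G (ambient T) := by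
  simp [IsIndep, ambient, localize]

variable [DecidableEq V]

theorem isIndep_localize_iff_union (hS : IsIndep G S)
    (T : Finset {v : V // v ∈ localVerts G S}) :
    IsIndep (localize G S) T ↔ IsIndep G (S ∪ ambient T) := by
  rw [isIndep_localize]
  exact ⟨fun h => hS.union h (ambient_subset T), fun h => h.subset Finset.subset_union_right⟩

theorem card_union_ambient (T : Finset {v : V // v ∈ localVerts G S}) :
    (S ∪ ambient T).card = S.card + T.card := by
  rw [Finset.card_union_of_disjoint (disjoint_localVerts (ambient_subset T)), card_ambient]

theorem exists_union_ambient_eq {T : Finset V} (hT : IsIndep G T) (h : S ⊆ T) :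
    ∃ T' : Finset {v : V // v ∈ localVerts G S}, S ∪ ambient T' = T := by
  obtain ⟨T', hT'⟩ := exists_ambient_eq (hT.sdiff_subset_localVerts h)
  exact ⟨T', by rw [hT', Finset.union_sdiff_of_subset h]⟩

theorem ambient_localVerts (T : Finset {v : V // v ∈ localVerts G S}) :
    ambient (localVerts (localize G S) T) = localVerts G (S ∪ ambient T) := by
  ext v
  rw [localVerts_union]
  simp only [ambient, Finset.mem_map, mem_localVerts (G := localize G S),
    Function.Embedding.subtype_apply]
  constructor
  · rintro ⟨w, ⟨h1, h2⟩, rfl⟩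
    refine ⟨w.2, ?_, ?_⟩
    · rintro ⟨u, hu, huw⟩
      exact h1 (Subtype.ext huw ▸ hu)
    · rintro t ⟨u, hu, rfl⟩
      exact h2 u hu
  · rintro ⟨h1, h2, h3⟩
    exact ⟨⟨v, h1⟩, ⟨fun hv => h2 ⟨_, hv, rfl⟩, fun s hs => h3 s ⟨s, hs, rfl⟩⟩, rfl⟩

theorem card_localVerts_localize (T : Finset {v : V // v ∈ localVerts G S}) :
    (localVerts (localize G S) T).card = (localVerts G (S ∪ ambient T)).card := by
  rw [← ambient_localVerts, card_ambient]

theorem HasLargeFibers.alpha_localize {p : ℕ} (h : HasLargeFibers G p) (hS : IsIndep G S) :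
    S.card + alpha (localize G S) = alpha G := by
  apply le_antisymm
  · obtain ⟨T, hT⟩ := exists_isMaxIndep (localize G S)
    rw [← hT.2, ← card_union_ambient]
    exact ((isIndep_localize_iff_union hS T).1 hT.1).card_le_alpha
  · obtain ⟨M, hM, hSM⟩ := h.1 S hS
    obtain ⟨T, rfl⟩ := exists_union_ambient_eq hM.1 hSM
    rw [← hM.2, card_union_ambient]
    exact Nat.add_le_add_left ((isIndep_localize_iff_union hS T).2 hM.1).card_le_alpha _

theorem HasLargeFibers.localize {p : ℕ} (h : HasLargeFibers G p) (hS : IsIndep G S) :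
    HasLargeFibers (localize G S) p := by
  have hα := h.alpha_localize hS
  refine ⟨fun A hA => ?_, fun T hT hc => ?_⟩
  · obtain ⟨M, hM, hAM⟩ := h.1 _ ((isIndep_localize_iff_union hS A).1 hA)
    obtain ⟨T, rfl⟩ := exists_union_ambient_eq hM.1 (Finset.subset_union_left.trans hAM)
    refine ⟨T, ⟨(isIndep_localize_iff_union hS T).2 hM.1, ?_⟩, ?_⟩
    · have := hM.2
      rw [card_union_ambient] at this
      omega
    · rw [← Finset.map_subset_map (f := Function.Embedding.subtype _)]
      exact (disjoint_localVerts (ambient_subset A)).symm.left_le_of_le_sup_left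
        (Finset.subset_union_right.trans hAM)
  · rw [card_localVerts_localize]
    refine h.2 _ ((isIndep_localize_iff_union hS T).1 hT) ?_
    rw [card_union_ambient]
    omega

theorem hasLargeFibers_of_localize {p : ℕ} (hα : 2 ≤ alpha G)
    (h : ∀ x : V, HasLargeFibers (_root_.localize G {x}) p ∧
      alpha (_root_.localize G {x}) = alpha G - 1) :
    HasLargeFibers G p := by
  refine ⟨fun A hA => ?_, fun S hS hc => ?_⟩
  · rcases A.eq_empty_or_nonempty with rfl | ⟨x, hx⟩
    · obtain ⟨M, hM⟩ := exists_isMaxIndep G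
      exact ⟨M, hM, Finset.empty_subset _⟩
    obtain ⟨T, rfl⟩ := exists_union_ambient_eq hA (Finset.singleton_subset_iff.2 hx)
    obtain ⟨M, hM, hTM⟩ := (h x).1.1 T ((isIndep_localize_iff_union (isIndep_singleton x) T).2 hA)
    refine ⟨{x} ∪ ambient M,
      ⟨(isIndep_localize_iff_union (isIndep_singleton x) M).1 hM.1, ?_⟩,
      Finset.union_subset_union_right (Finset.map_subset_map.2 hTM)⟩
    rw [card_union_ambient, hM.2, (h x).2, Finset.card_singleton]
    omega
  · obtain ⟨x, hx⟩ : S.Nonempty := Finset.card_pos.1 (by omega)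
    obtain ⟨T, rfl⟩ := exists_union_ambient_eq hS (Finset.singleton_subset_iff.2 hx)
    rw [← card_localVerts_localize]
    refine (h x).1.2 T ((isIndep_localize_iff_union (isIndep_singleton x) T).2 hS) ?_
    rw [card_union_ambient, Finset.card_singleton] at hc
    rw [(h x).2]
    omega

end Localization

/-- Localization theorem for `W_p` graphs. -/
theorem wp_localization {V : Type*} [Fintype V] [DecidableEq V]
    (G : SimpleGraph V) (p : ℕ) (hp : 1 ≤ p) (halpha : 2 ≤ alpha G) :
    (MemW G p ↔
      ∀ x : V, MemW (localize G {x}) p ∧ alpha (localize G {x}) = alpha G - 1) ∧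
      (∀ S : Finset V, MemW G p → IsIndep G S → S.card < alpha G →
        MemW (localize G S) p ∧ alpha (localize G S) = alpha G - S.card) := by
  have hloc : ∀ S : Finset V, MemW G p → IsIndep G S → S.card < alpha G →
      MemW (localize G S) p ∧ alpha (localize G S) = alpha G - S.card := by
    intro S hG hS hc
    have h := hG.hasLargeFibers hp
    have hα := h.alpha_localize hS
    exact ⟨(h.localize hS).memW (by omega), by omega⟩
  refine ⟨⟨fun hG x => ?_, fun h => ?_⟩, hloc⟩
  · simpa using hloc {x} hG (isIndep_singleton x) (by rw [Finset.card_singleton]; omega)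
  · exact (hasLargeFibers_of_localize halpha fun x =>
      ⟨(h x).1.hasLargeFibers hp, (h x).2⟩).memW (by omega)
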